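/- arXiv:1404.4429 — 2 statements merged into one kernel-verified Lean document; each statement's English description precedes it below -/
import Mathlib

section
/- For Jacobi polynomials P_j^{a,b} with a,b > −1 and α > 0, define P̂^{a,b,α}_{R,j}(x) = (1/Γ(α)) ∫_x^1 (s−x)^{α−1} P_j^{a,b}(s) ds. Then for j ≥ 1, (1 + α A_j Ĉ_j) P̂_{R,j+1}(x) = (A_j x − B_j − α A_j B̂_j) P̂_{R,j}(x) − (C_j + α A_j Â_j) P̂_{R,j−1}(x) + (α A_j / Γ(α+1)) (Â_j P^{a,b}_{j−1}(1) + B̂_j P^{a,b}_j(1) + Ĉ_j P^{a,b}_{j+1}(1)) (1−x)^α, where A_j, B_j, C_j are the three-term recurrence coefficients of the Jacobi polynomials and Â_j, B̂_j, Ĉ_j are the coefficients expressing P^{a,b}_j as a combination of derivatives of P^{a,b}_{j−1}, P^{a,b}_j, P^{a,b}_{j+1}. -/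
open MeasureTheory intervalIntegral

/-- Three-term recurrence coefficient `A_j^{a,b}` for the Jacobi polynomials. -/
noncomputable def jacobiA (a b : ℝ) (j : ℕ) : ℝ :=
  ((2 * (j : ℝ) + a + b + 1) * (2 * (j : ℝ) + a + b + 2)) /
    (2 * ((j : ℝ) + 1) * ((j : ℝ) + a + b + 1))

/-- Three-term recurrence coefficient `B_j^{a,b}` for the Jacobi polynomials. -/
noncomputable def jacobiB (a b : ℝ) (j : ℕ) : ℝ :=
  ((b ^ 2 - a ^ 2) * (2 * (j : ℝ) + a + b + 1)) /
    (2 * ((j : ℝ) + 1) * ((j : ℝ) + a + b + 1) * (2 * (j : ℝ) + a + b))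

/-- Three-term recurrence coefficient `C_j^{a,b}` for the Jacobi polynomials. -/
noncomputable def jacobiC (a b : ℝ) (j : ℕ) : ℝ :=
  (((j : ℝ) + a) * ((j : ℝ) + b) * (2 * (j : ℝ) + a + b + 2)) /
    (((j : ℝ) + 1) * ((j : ℝ) + a + b + 1) * (2 * (j : ℝ) + a + b))

/-- The Jacobi polynomials `P^{a,b}_j` via the three-term recurrence. -/
noncomputable def jacobiP (a b : ℝ) : ℕ → ℝ → ℝ
  | 0 => fun _ => 1
  | 1 => fun x => (a + b + 2) / 2 * x + (a - b) / 2
  | (j + 2) => fun x =>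
      (jacobiA a b (j + 1) * x - jacobiB a b (j + 1)) * jacobiP a b (j + 1) x -
        jacobiC a b (j + 1) * jacobiP a b j x

/-- Coefficient `Â_j^{a,b}`. -/
noncomputable def jacobiAhat (a b : ℝ) (j : ℕ) : ℝ :=
  (-2 * ((j : ℝ) + a) * ((j : ℝ) + b)) /
    (((j : ℝ) + a + b) * (2 * (j : ℝ) + a + b) * (2 * (j : ℝ) + a + b + 1))

/-- Coefficient `B̂_j^{a,b}`. -/
noncomputable def jacobiBhat (a b : ℝ) (j : ℕ) : ℝ :=
  (2 * (a - b)) / ((2 * (j : ℝ) + a + b) * (2 * (j : ℝ) + a + b + 2))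

/-- Coefficient `Ĉ_j^{a,b}`. -/
noncomputable def jacobiChat (a b : ℝ) (j : ℕ) : ℝ :=
  (2 * ((j : ℝ) + a + b + 1)) / ((2 * (j : ℝ) + a + b + 1) * (2 * (j : ℝ) + a + b + 2))


lemma jacobi_alg_S (n a b x p0 p1 p2 d0 d1 d2 : ℝ) (h1 : 2 * n + a + b ≠ 0)
    (h2 : n + 1 ≠ 0) (h3 : n + a + b + 1 ≠ 0)
    (rP : 2 * (n + 1) * (n + a + b + 1) * (2 * n + a + b) * p2 =
      ((2 * n + a + b + 1) * (2 * n + a + b + 2) * (2 * n + a + b) * x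
        - (b ^ 2 - a ^ 2) * (2 * n + a + b + 1)) * p1
        - 2 * (n + a) * (n + b) * (2 * n + a + b + 2) * p0)
    (rD : 2 * (n + 1) * (n + a + b + 1) * (2 * n + a + b) * d2 =
      (2 * n + a + b + 1) * (2 * n + a + b + 2) * (2 * n + a + b) * p1 +
      ((2 * n + a + b + 1) * (2 * n + a + b + 2) * (2 * n + a + b) * x
        - (b ^ 2 - a ^ 2) * (2 * n + a + b + 1)) * d1
        - 2 * (n + a) * (n + b) * (2 * n + a + b + 2) * d0)
    (T : (2 * n + a + b) * (1 - x ^ 2) * d0 =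
      (n + a + b) * ((a - b + (2 * n + a + b) * x) * p0 - 2 * n * p1))
    (S : (2 * n + a + b) * (1 - x ^ 2) * d1 =
      n * (a - b - (2 * n + a + b) * x) * p1 + 2 * (n + a) * (n + b) * p0) :
    (2 * n + a + b + 2) * (1 - x ^ 2) * d2 =
      (n + 1) * (a - b - (2 * n + a + b + 2) * x) * p2
        + 2 * (n + 1 + a) * (n + 1 + b) * p1 := by
  have hK : (2 * n + a + b) * (2 * (n + 1) * (n + a + b + 1) * (2 * n + a + b)) ≠ 0 := by
    positivity
  apply mul_left_cancel₀ hK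
  linear_combination (2 * n + a + b) * (2 * n + a + b + 2) * (1 - x ^ 2) * rD
    + (2 * n + a + b + 2) * ((2 * n + a + b + 1) * (2 * n + a + b + 2) * (2 * n + a + b) * x
        - (b ^ 2 - a ^ 2) * (2 * n + a + b + 1)) * S
    - (2 * n + a + b + 2) * (2 * (n + a) * (n + b) * (2 * n + a + b + 2)) * T
    - (2 * n + a + b) * (n + 1) * (a - b - (2 * n + a + b + 2) * x) * rP

lemma jacobi_alg_T (n a b x p0 p1 p2 d1 : ℝ) (h1 : 2 * n + a + b ≠ 0)
    (rP : 2 * (n + 1) * (n + a + b + 1) * (2 * n + a + b) * p2 =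
      ((2 * n + a + b + 1) * (2 * n + a + b + 2) * (2 * n + a + b) * x
        - (b ^ 2 - a ^ 2) * (2 * n + a + b + 1)) * p1
        - 2 * (n + a) * (n + b) * (2 * n + a + b + 2) * p0)
    (S : (2 * n + a + b) * (1 - x ^ 2) * d1 =
      n * (a - b - (2 * n + a + b) * x) * p1 + 2 * (n + a) * (n + b) * p0) :
    (2 * n + a + b + 2) * (1 - x ^ 2) * d1 =
      (n + a + b + 1) * ((a - b + (2 * n + a + b + 2) * x) * p1 - 2 * (n + 1) * p2) := by
  apply mul_left_cancel₀ h1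
  linear_combination (2 * n + a + b + 2) * S + rP

lemma jacobiP_differentiable (a b : ℝ) (n : ℕ) :
    Differentiable ℝ (jacobiP a b n) ∧ Differentiable ℝ (jacobiP a b (n + 1)) := by
  induction n with
  | zero => constructor <;> (simp only [jacobiP]; fun_prop)
  | succ k ih =>
    obtain ⟨h0, h1⟩ := ih
    refine ⟨h1, ?_⟩
    simp only [jacobiP]
    fun_prop

lemma jacobiP_rec (a b : ℝ) (n : ℕ) (x : ℝ) : jacobiP a b (n + 2) x =
      (jacobiA a b (n + 1) * x - jacobiB a b (n + 1)) * jacobiP a b (n + 1) x -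
        jacobiC a b (n + 1) * jacobiP a b n x := by
  simp only [jacobiP]

lemma jacobiP_rec_deriv (a b : ℝ) (n : ℕ) (x : ℝ) : deriv (jacobiP a b (n + 2)) x =
      jacobiA a b (n + 1) * jacobiP a b (n + 1) x +
      (jacobiA a b (n + 1) * x - jacobiB a b (n + 1)) * deriv (jacobiP a b (n + 1)) x -
        jacobiC a b (n + 1) * deriv (jacobiP a b n) x := by
  have h0 := ((jacobiP_differentiable a b n).1 x).hasDerivAt
  have h1 := ((jacobiP_differentiable a b n).2 x).hasDerivAt
  have h2 := (((((hasDerivAt_id x).const_mul (jacobiA a b (n + 1))).sub_const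
    (jacobiB a b (n + 1))).mul h1).sub (h0.const_mul (jacobiC a b (n + 1)))).deriv
  have h3 : jacobiP a b (n + 2) = fun x =>
      (jacobiA a b (n + 1) * x - jacobiB a b (n + 1)) * jacobiP a b (n + 1) x -
        jacobiC a b (n + 1) * jacobiP a b n x := by
    funext x; exact jacobiP_rec a b n x
  rw [h3]
  refine Eq.trans h2 ?_
  simp

lemma jacobi_recs (a b : ℝ) (ha : -1 < a) (hb : -1 < b) (k : ℕ) (n : ℝ) (hn : n = k + 1)
    (x : ℝ) :
    (2 * (n + 1) * (n + a + b + 1) * (2 * n + a + b) * jacobiP a b (k + 2) x =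
      ((2 * n + a + b + 1) * (2 * n + a + b + 2) * (2 * n + a + b) * x
        - (b ^ 2 - a ^ 2) * (2 * n + a + b + 1)) * jacobiP a b (k + 1) x
        - 2 * (n + a) * (n + b) * (2 * n + a + b + 2) * jacobiP a b k x) ∧
    (2 * (n + 1) * (n + a + b + 1) * (2 * n + a + b) * deriv (jacobiP a b (k + 2)) x =
      (2 * n + a + b + 1) * (2 * n + a + b + 2) * (2 * n + a + b) * jacobiP a b (k + 1) x +
      ((2 * n + a + b + 1) * (2 * n + a + b + 2) * (2 * n + a + b) * x
        - (b ^ 2 - a ^ 2) * (2 * n + a + b + 1)) * deriv (jacobiP a b (k + 1)) x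
        - 2 * (n + a) * (n + b) * (2 * n + a + b + 2) * deriv (jacobiP a b k) x) := by
  have hk : (0 : ℝ) ≤ k := Nat.cast_nonneg k
  have h1 : 2 * n + a + b ≠ 0 := by intro h; linarith
  have h2 : n + 1 ≠ 0 := by intro h; linarith
  have h3 : n + a + b + 1 ≠ 0 := by intro h; linarith
  have hc : ((k + 1 : ℕ) : ℝ) = n := by rw [hn]; push_cast; ring
  have eA : 2 * (n + 1) * (n + a + b + 1) * (2 * n + a + b) * jacobiA a b (k + 1) =
      (2 * n + a + b + 1) * (2 * n + a + b + 2) * (2 * n + a + b) := by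
    unfold jacobiA; rw [hc]; field_simp
  have eB : 2 * (n + 1) * (n + a + b + 1) * (2 * n + a + b) * jacobiB a b (k + 1) =
      (b ^ 2 - a ^ 2) * (2 * n + a + b + 1) := by
    unfold jacobiB; rw [hc]; field_simp
  have eC : 2 * (n + 1) * (n + a + b + 1) * (2 * n + a + b) * jacobiC a b (k + 1) =
      2 * (n + a) * (n + b) * (2 * n + a + b + 2) := by
    unfold jacobiC; rw [hc]; field_simp
  constructor
  · rw [jacobiP_rec, ← eA, ← eB, ← eC]; ring
  · rw [jacobiP_rec_deriv, ← eA, ← eB, ← eC]; ring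

lemma jacobi_TS (a b : ℝ) (ha : -1 < a) (hb : -1 < b) (x : ℝ) (k : ℕ) : ∀ n : ℝ, n = k + 1 →
    ((2 * n + a + b) * (1 - x ^ 2) * deriv (jacobiP a b k) x =
      (n + a + b) * ((a - b + (2 * n + a + b) * x) * jacobiP a b k x
        - 2 * n * jacobiP a b (k + 1) x)) ∧
    ((2 * n + a + b) * (1 - x ^ 2) * deriv (jacobiP a b (k + 1)) x =
      n * (a - b - (2 * n + a + b) * x) * jacobiP a b (k + 1) x
        + 2 * (n + a) * (n + b) * jacobiP a b k x) := by
  induction k with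
  | zero =>
    rintro n hn
    simp only [Nat.cast_zero, zero_add] at hn
    subst hn
    have h1 : deriv (jacobiP a b 1) x = (a + b + 2) / 2 := by
      have : HasDerivAt (fun x : ℝ => (a + b + 2) / 2 * x + (a - b) / 2) ((a + b + 2) / 2 * 1) x :=
        ((hasDerivAt_id x).const_mul _).add_const _
      simp only [jacobiP]
      rw [this.deriv]; ring
    have h0 : deriv (jacobiP a b 0) x = 0 := by
      simp only [jacobiP]; simp
    simp only [zero_add]
    rw [h0, h1]
    simp only [jacobiP]
    constructor <;> ring
  | succ k ih =>
    intro m hm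
    push_cast at hm
    obtain ⟨n, hn⟩ : ∃ n : ℝ, n = k + 1 := ⟨_, rfl⟩
    have hk : (0 : ℝ) ≤ k := Nat.cast_nonneg k
    have h1 : 2 * n + a + b ≠ 0 := by intro h; linarith
    have h2 : n + 1 ≠ 0 := by intro h; linarith
    have h3 : n + a + b + 1 ≠ 0 := by intro h; linarith
    obtain ⟨T, S⟩ := ih n hn
    obtain ⟨rP, rD⟩ := jacobi_recs a b ha hb k n hn x
    have hS := jacobi_alg_S n a b x _ _ _ _ _ _ h1 h2 h3 rP rD T S
    have hT := jacobi_alg_T n a b x _ _ _ _ h1 rP S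
    have hmn : m = n + 1 := by rw [hm, hn]
    subst hmn
    constructor
    · linear_combination hT
    · linear_combination hS

lemma jacobi_deriv_id (a b : ℝ) (ha : -1 < a) (hb : -1 < b) (k : ℕ) (x : ℝ)
    (hx : 1 - x ^ 2 ≠ 0) :
    jacobiP a b (k + 1) x = jacobiAhat a b (k + 1) * deriv (jacobiP a b k) x
      + jacobiBhat a b (k + 1) * deriv (jacobiP a b (k + 1)) x
      + jacobiChat a b (k + 1) * deriv (jacobiP a b (k + 2)) x := by
  obtain ⟨n, hn⟩ : ∃ n : ℝ, n = k + 1 := ⟨_, rfl⟩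
  have hc : ((k + 1 : ℕ) : ℝ) = n := by rw [hn]; push_cast; ring
  have hk : (0 : ℝ) ≤ k := Nat.cast_nonneg k
  have h1 : 2 * n + a + b ≠ 0 := by intro h; linarith
  have h2 : n + 1 ≠ 0 := by intro h; linarith
  have h3 : n + a + b + 1 ≠ 0 := by intro h; linarith
  have h4 : 2 * n + a + b + 1 ≠ 0 := by intro h; linarith
  have h5 : 2 * n + a + b + 2 ≠ 0 := by intro h; linarith
  obtain ⟨T, S⟩ := jacobi_TS a b ha hb x k n hn
  obtain ⟨-, S2⟩ := jacobi_TS a b ha hb x (k + 1) (n + 1) (by push_cast; rw [hn])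
  obtain ⟨rP, -⟩ := jacobi_recs a b ha hb k n hn x
  have hA : (2 * n + a + b) ^ 2 * (2 * n + a + b + 1) *
      (jacobiAhat a b (k + 1) * ((1 - x ^ 2) * deriv (jacobiP a b k) x)) =
      -2 * (n + a) * (n + b) * ((a - b + (2 * n + a + b) * x) * jacobiP a b k x
        - 2 * n * jacobiP a b (k + 1) x) := by
    by_cases h0 : n + a + b = 0
    · have hk0 : k = 0 := by
        have : (k : ℝ) < 1 := by linarith
        have : k < 1 := by exact_mod_cast this
        omega
      subst hk0
      have hn1 : n = 1 := by simpa using hn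
      have : jacobiAhat a b (0 + 1) = 0 := by
        unfold jacobiAhat; rw [hc, h0]; simp
      rw [this]
      subst hn1
      have hb' : b = -1 - a := by linarith
      subst hb'
      simp only [jacobiP]
      ring
    · have e : (n + a + b) * (2 * n + a + b) * (2 * n + a + b + 1) * jacobiAhat a b (k + 1) =
          -2 * (n + a) * (n + b) := by
        unfold jacobiAhat; rw [hc, mul_comm]
        exact div_mul_cancel₀ _ (mul_ne_zero (mul_ne_zero h0 h1) h4)
      apply mul_left_cancel₀ h0
      linear_combination (2 * n + a + b) * ((1 - x ^ 2) * deriv (jacobiP a b k) x) * e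
        + (-2 * (n + a) * (n + b)) * T
  have eB : (2 * n + a + b) * (2 * n + a + b + 2) * jacobiBhat a b (k + 1) = 2 * (a - b) := by
    unfold jacobiBhat; rw [hc]; field_simp
  have eC : (2 * n + a + b + 1) * (2 * n + a + b + 2) * jacobiChat a b (k + 1) =
      2 * (n + a + b + 1) := by
    unfold jacobiChat; rw [hc]; field_simp
  have hB : (2 * n + a + b) ^ 2 * (2 * n + a + b + 2) *
      (jacobiBhat a b (k + 1) * ((1 - x ^ 2) * deriv (jacobiP a b (k + 1)) x)) =
      2 * (a - b) * (n * (a - b - (2 * n + a + b) * x) * jacobiP a b (k + 1) x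
        + 2 * (n + a) * (n + b) * jacobiP a b k x) := by
    linear_combination (2 * n + a + b) * ((1 - x ^ 2) * deriv (jacobiP a b (k + 1)) x) * eB
      + 2 * (a - b) * S
  have hC : (2 * n + a + b + 1) * (2 * n + a + b + 2) ^ 2 *
      (jacobiChat a b (k + 1) * ((1 - x ^ 2) * deriv (jacobiP a b (k + 2)) x)) =
      2 * (n + a + b + 1) * ((n + 1) * (a - b - (2 * n + a + b + 2) * x) * jacobiP a b (k + 2) x
        + 2 * (n + 1 + a) * (n + 1 + b) * jacobiP a b (k + 1) x) := by
    linear_combination (2 * n + a + b + 2) * ((1 - x ^ 2) * deriv (jacobiP a b (k + 2)) x) * eC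
      + 2 * (n + a + b + 1) * S2
  have hK : (2 * n + a + b) ^ 2 * (2 * n + a + b + 1) * (2 * n + a + b + 2) ^ 2 * (1 - x ^ 2) ≠ 0 := by
    positivity
  apply mul_left_cancel₀ hK
  linear_combination (-(2 * n + a + b + 2) ^ 2) * hA
    - (2 * n + a + b + 1) * (2 * n + a + b + 2) * hB - (2 * n + a + b) ^ 2 * hC
    - (2 * n + a + b) * (a - b - (2 * n + a + b + 2) * x) * rP

/-- Recurrence for the right fractional integrals `P̂^{a,b,α}_{R,j}` of the Jacobi
polynomials, for `j ≥ 1`. -/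
theorem jacobi_right_frac_integral_rec (a b : ℝ) (ha : -1 < a) (hb : -1 < b)
    (α : ℝ) (hα : 0 < α) (j : ℕ) (hj : 1 ≤ j) (x : ℝ) (hx : x ∈ Set.Ico (-1 : ℝ) 1) :
    (1 + α * jacobiA a b j * jacobiChat a b j) *
        ((1 / Real.Gamma α) * ∫ s in x..(1 : ℝ), (s - x) ^ (α - 1) * jacobiP a b (j + 1) s)
      = (jacobiA a b j * x - jacobiB a b j - α * jacobiA a b j * jacobiBhat a b j) *
          ((1 / Real.Gamma α) * ∫ s in x..(1 : ℝ), (s - x) ^ (α - 1) * jacobiP a b j s)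
        - (jacobiC a b j + α * jacobiA a b j * jacobiAhat a b j) *
          ((1 / Real.Gamma α) * ∫ s in x..(1 : ℝ), (s - x) ^ (α - 1) * jacobiP a b (j - 1) s)
        + (α * jacobiA a b j / Real.Gamma (α + 1)) *
            (jacobiAhat a b j * jacobiP a b (j - 1) 1 + jacobiBhat a b j * jacobiP a b j 1
              + jacobiChat a b j * jacobiP a b (j + 1) 1) * (1 - x) ^ α := by
  
  obtain ⟨k, rfl⟩ : ∃ k, j = k + 1 := ⟨j - 1, by omega⟩
  simp only [Nat.add_sub_cancel]
  obtain ⟨hx1, hx2⟩ := hx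
  have hd : ∀ n, Differentiable ℝ (jacobiP a b n) := fun n => (jacobiP_differentiable a b n).1
  have hw : IntervalIntegrable (fun s : ℝ => (s - x) ^ (α - 1)) volume x 1 := by
    have h := (intervalIntegral.intervalIntegrable_rpow' (a := x - x) (b := 1 - x)
      (r := α - 1) (by linarith)).comp_sub_right x
    simpa using h
  have hI : ∀ n, IntervalIntegrable (fun s : ℝ => (s - x) ^ (α - 1) * jacobiP a b n s)
      volume x 1 := fun n => hw.mul_continuousOn (hd n).continuous.continuousOn
  have hJ : IntervalIntegrable (fun s : ℝ => (s - x) ^ α * jacobiP a b (k + 1) s)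
      volume x 1 := by
    apply Continuous.intervalIntegrable
    exact ((continuous_id.sub continuous_const).rpow_const (fun _ => Or.inr hα.le)).mul
      (hd _).continuous
  set F : ℝ → ℝ := fun s => jacobiAhat a b (k + 1) * jacobiP a b k s
    + jacobiBhat a b (k + 1) * jacobiP a b (k + 1) s
    + jacobiChat a b (k + 1) * jacobiP a b (k + 1 + 1) s with hF
  set I0 := ∫ s in x..(1 : ℝ), (s - x) ^ (α - 1) * jacobiP a b k s with hI0
  set I1 := ∫ s in x..(1 : ℝ), (s - x) ^ (α - 1) * jacobiP a b (k + 1) s with hI1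
  set I2 := ∫ s in x..(1 : ℝ), (s - x) ^ (α - 1) * jacobiP a b (k + 1 + 1) s with hI2
  set J := ∫ s in x..(1 : ℝ), (s - x) ^ α * jacobiP a b (k + 1) s with hJdef
  have hFd : Differentiable ℝ F := by
    have := hd k
    have := hd (k + 1)
    have := hd (k + 1 + 1)
    fun_prop
  have hFI : IntervalIntegrable (fun s : ℝ => (s - x) ^ (α - 1) * F s) volume x 1 :=
    hw.mul_continuousOn hFd.continuous.continuousOn
  have hIF : ∫ s in x..(1 : ℝ), (s - x) ^ (α - 1) * F s =
      jacobiAhat a b (k + 1) * I0 + jacobiBhat a b (k + 1) * I1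
        + jacobiChat a b (k + 1) * I2 := by
    rw [hI0, hI1, hI2, ← intervalIntegral.integral_const_mul,
      ← intervalIntegral.integral_const_mul, ← intervalIntegral.integral_const_mul,
      ← intervalIntegral.integral_add ((hI _).const_mul _) ((hI _).const_mul _),
      ← intervalIntegral.integral_add (((hI _).const_mul _).add ((hI _).const_mul _))
        ((hI _).const_mul _)]
    congr 1
    funext s
    simp only [hF]
    ring
  have hparts : α * (∫ s in x..(1 : ℝ), (s - x) ^ (α - 1) * F s) + J = (1 - x) ^ α * F 1 := by
    rw [hJdef, ← intervalIntegral.integral_const_mul,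
      ← intervalIntegral.integral_add (hFI.const_mul _) hJ]
    rw [intervalIntegral.integral_eq_sub_of_hasDerivAt_of_le (f := fun s => (s - x) ^ α * F s)
      hx2.le]
    · simp [Real.zero_rpow hα.ne']
    · exact (((continuous_id.sub continuous_const).rpow_const (fun _ => Or.inr hα.le)).mul
        hFd.continuous).continuousOn
    · intro s hs
      have hs1 : s - x ≠ 0 := by have := hs.1; intro h; linarith
      have hs2 : 1 - s ^ 2 ≠ 0 := by
        have h1 := hs.1
        have h2 := hs.2
        nlinarith
      have hFs : HasDerivAt F (jacobiP a b (k + 1) s) s := by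
        rw [jacobi_deriv_id a b ha hb k s hs2]
        exact (((hd k s).hasDerivAt.const_mul _).add ((hd (k + 1) s).hasDerivAt.const_mul _)).add
          ((hd (k + 2) s).hasDerivAt.const_mul _)
      have hp : HasDerivAt (fun s : ℝ => (s - x) ^ α) (1 * α * (s - x) ^ (α - 1)) s :=
        ((hasDerivAt_id s).sub_const x).rpow_const (Or.inl hs1)
      refine (hp.mul hFs).congr_deriv ?_
      ring
    · exact (hFI.const_mul _).add hJ
  have hrec : I2 = (jacobiA a b (k + 1) * x - jacobiB a b (k + 1)) * I1
      - jacobiC a b (k + 1) * I0 + jacobiA a b (k + 1) * J := by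
    rw [hI0, hI1, hI2, hJdef, ← intervalIntegral.integral_const_mul,
      ← intervalIntegral.integral_const_mul, ← intervalIntegral.integral_const_mul,
      ← intervalIntegral.integral_sub ((hI _).const_mul _) ((hI _).const_mul _),
      ← intervalIntegral.integral_add (((hI _).const_mul _).sub ((hI _).const_mul _))
        (hJ.const_mul _)]
    rw [intervalIntegral.integral_of_le hx2.le, intervalIntegral.integral_of_le hx2.le]
    apply setIntegral_congr_fun measurableSet_Ioc
    intro s hs
    have hs1 : 0 < s - x := by have := hs.1; linarith
    have e : (s - x) ^ α = (s - x) ^ (α - 1) * (s - x) := by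
      rw [Real.rpow_sub_one hs1.ne']; field_simp
    simp only [e]
    rw [jacobiP_rec]
    ring
  rw [hIF] at hparts
  have hF1 : jacobiAhat a b (k + 1) * jacobiP a b k 1
    + jacobiBhat a b (k + 1) * jacobiP a b (k + 1) 1
    + jacobiChat a b (k + 1) * jacobiP a b (k + 1 + 1) 1 = F 1 := rfl
  rw [hF1, Real.Gamma_add_one hα.ne']
  have hG : Real.Gamma α ≠ 0 := (Real.Gamma_pos_of_pos hα).ne'
  have hα0 := hα.ne'
  have e1 : α * jacobiA a b (k + 1) / (α * Real.Gamma α) =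
      1 / Real.Gamma α * jacobiA a b (k + 1) := by field_simp
  rw [e1]
  linear_combination (1 / Real.Gamma α) * hrec + (1 / Real.Gamma α) * jacobiA a b (k + 1) * hparts
end

section
/- For Jacobi polynomials P_j^{a,b} with a,b > −1 and α > 0, define P̂^{a,b,α}_{L,j}(x) = (1/Γ(α)) ∫_{-1}^x (x−s)^{α−1} P_j^{a,b}(s) ds. Then for j ≥ 1, (1 + α A_j Ĉ_j) P̂_{L,j+1}(x) = (A_j x − B_j − α A_j B̂_j) P̂_{L,j}(x) − (C_j + α A_j Â_j) P̂_{L,j−1}(x) + (α A_j / Γ(α+1)) (Â_j P^{a,b}_{j−1}(−1) + B̂_j P^{a,b}_j(−1) + Ĉ_j P^{a,b}_{j+1}(−1)) (x+1)^α. -/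
open MeasureTheory intervalIntegral

/-- Derivatives of the Jacobi polynomials, by the differentiated recurrence. -/
noncomputable def jacobiQ (a b : ℝ) : ℕ → ℝ → ℝ
  | 0 => fun _ => 0
  | 1 => fun _ => (a + b + 2) / 2
  | (j + 2) => fun x =>
      jacobiA a b (j + 1) * jacobiP a b (j + 1) x +
      (jacobiA a b (j + 1) * x - jacobiB a b (j + 1)) * jacobiQ a b (j + 1) x -
        jacobiC a b (j + 1) * jacobiQ a b j x

theorem jacobiP_hasDerivAt (a b : ℝ) (n : ℕ) (x : ℝ) :
    HasDerivAt (jacobiP a b n) (jacobiQ a b n x) x := by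
  induction n using Nat.twoStepInduction with
  | zero => simpa [jacobiP, jacobiQ] using hasDerivAt_const x (1 : ℝ)
  | one =>
    have h := ((hasDerivAt_id x).const_mul ((a + b + 2) / 2)).add_const ((a - b) / 2)
    simpa [jacobiP, jacobiQ] using h
  | more n h0 h1 =>
    have h := (((((hasDerivAt_id x).const_mul (jacobiA a b (n + 1))).sub_const
      (jacobiB a b (n + 1))).mul h1).sub (h0.const_mul (jacobiC a b (n + 1))))
    have e : jacobiQ a b (n + 2) x = jacobiA a b (n + 1) * 1 * jacobiP a b (n + 1) x +
      (jacobiA a b (n + 1) * id x - jacobiB a b (n + 1)) * jacobiQ a b (n + 1) x -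
        jacobiC a b (n + 1) * jacobiQ a b n x := by
      simp [jacobiQ]
    rw [e]
    exact h

theorem jacobiP_continuous (a b : ℝ) (n : ℕ) : Continuous (jacobiP a b n) :=
  continuous_iff_continuousAt.2 fun x => (jacobiP_hasDerivAt a b n x).continuousAt

theorem jacobiP_cleared (a b : ℝ) (ha : -1 < a) (hb : -1 < b) (n : ℕ) (k x : ℝ)
    (hk : k = (n : ℝ) + 1) :
    2 * (k + 1) * (k + (a + b) + 1) * (2 * k + (a + b)) * jacobiP a b (n + 2) x =
      (2 * k + (a + b) + 1) * ((2 * k + (a + b) + 2) * (2 * k + (a + b)) * x + a ^ 2 - b ^ 2)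
        * jacobiP a b (n + 1) x
      - 2 * (k + a) * (k + b) * (2 * k + (a + b) + 2) * jacobiP a b n x := by
  have hn : (0 : ℝ) ≤ n := Nat.cast_nonneg n
  have h1 : k + 1 ≠ 0 := by linarith
  have h2 : k + a + b + 1 ≠ 0 := by linarith
  have h3 : 2 * k + a + b ≠ 0 := by linarith
  simp only [jacobiP, jacobiA, jacobiB, jacobiC]
  push_cast
  rw [← hk]
  field_simp
  ring

theorem jacobiQ_cleared (a b : ℝ) (ha : -1 < a) (hb : -1 < b) (n : ℕ) (k x : ℝ)
    (hk : k = (n : ℝ) + 1) :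
    2 * (k + 1) * (k + (a + b) + 1) * (2 * k + (a + b)) * jacobiQ a b (n + 2) x =
      (2 * k + (a + b) + 1) * (2 * k + (a + b) + 2) * (2 * k + (a + b)) * jacobiP a b (n + 1) x +
      (2 * k + (a + b) + 1) * ((2 * k + (a + b) + 2) * (2 * k + (a + b)) * x + a ^ 2 - b ^ 2)
        * jacobiQ a b (n + 1) x
      - 2 * (k + a) * (k + b) * (2 * k + (a + b) + 2) * jacobiQ a b n x := by
  have hn : (0 : ℝ) ≤ n := Nat.cast_nonneg n
  have h1 : k + 1 ≠ 0 := by linarith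
  have h2 : k + a + b + 1 ≠ 0 := by linarith
  have h3 : 2 * k + a + b ≠ 0 := by linarith
  simp only [jacobiQ, jacobiA, jacobiB, jacobiC]
  push_cast
  rw [← hk]
  field_simp
  ring

/-- The two structure relations. -/
theorem jacobi_structure (a b : ℝ) (ha : -1 < a) (hb : -1 < b) (n : ℕ) (x : ℝ) :
    ∀ k : ℝ, k = (n : ℝ) + 1 →
    (2 * k + (a + b)) * (1 - x ^ 2) * jacobiQ a b n x =
      (k + (a + b)) * ((a - b) + (2 * k + (a + b)) * x) * jacobiP a b n x
        - 2 * k * (k + (a + b)) * jacobiP a b (n + 1) x ∧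
    (2 * k + (a + b)) * (1 - x ^ 2) * jacobiQ a b (n + 1) x =
      k * (a - b - (2 * k + (a + b)) * x) * jacobiP a b (n + 1) x
        + 2 * (k + a) * (k + b) * jacobiP a b n x := by
  induction n with
  | zero =>
    rintro k rfl
    simp only [jacobiP, jacobiQ, Nat.cast_zero]
    constructor <;> ring
  | succ n ih =>
    rintro k' hk'
    obtain ⟨U0, T1⟩ := ih ((n : ℝ) + 1) rfl
    have hP := jacobiP_cleared a b ha hb n ((n : ℝ) + 1) x rfl
    have hQ := jacobiQ_cleared a b ha hb n ((n : ℝ) + 1) x rfl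
    have hn : (0 : ℝ) ≤ n := Nat.cast_nonneg n
    push_cast at hk'
    obtain ⟨k, hk⟩ : ∃ k : ℝ, k = (n : ℝ) + 1 := ⟨_, rfl⟩
    rw [← hk] at U0 T1 hP hQ hk'
    subst hk'
    have h1 : k + 1 ≠ 0 := by linarith
    have h2 : k + (a + b) + 1 ≠ 0 := by linarith
    have h3 : 2 * k + (a + b) ≠ 0 := by linarith
    rw [show n + 1 + 1 = n + 2 from rfl]
    generalize jacobiP a b n x = P0 at *
    generalize jacobiP a b (n + 1) x = P1 at *
    generalize jacobiP a b (n + 2) x = P2 at *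
    generalize jacobiQ a b n x = Q0 at *
    generalize jacobiQ a b (n + 1) x = Q1 at *
    generalize jacobiQ a b (n + 2) x = Q2 at *
    constructor
    · apply mul_left_cancel₀ h3
      linear_combination (2 * k + (a + b) + 2) * T1 + hP
    · apply mul_left_cancel₀ (mul_ne_zero (mul_ne_zero (mul_ne_zero (mul_ne_zero two_ne_zero h1) h2) h3) h3)
      linear_combination (2 * k + (a + b) + 2) * ((2 * k + (a + b)) * (1 - x ^ 2) * hQ +
        (2 * k + (a + b) + 1) * ((2 * k + (a + b) + 2) * (2 * k + (a + b)) * x + a ^ 2 - b ^ 2) * T1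
        - 2 * (k + a) * (k + b) * (2 * k + (a + b) + 2) * U0)
        - (k + 1) * (a - b - (2 * k + (a + b) + 2) * x) * (2 * k + (a + b)) * hP

theorem jacobi_deriv_rel (a b : ℝ) (ha : -1 < a) (hb : -1 < b) (n : ℕ) (x : ℝ)
    (hx : 1 - x ^ 2 ≠ 0) :
    jacobiP a b (n + 1) x = jacobiAhat a b (n + 1) * jacobiQ a b n x
      + jacobiBhat a b (n + 1) * jacobiQ a b (n + 1) x
      + jacobiChat a b (n + 1) * jacobiQ a b (n + 2) x := by
  obtain ⟨U0, T1⟩ := jacobi_structure a b ha hb n x ((n : ℝ) + 1) rfl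
  have hQ := jacobiQ_cleared a b ha hb n ((n : ℝ) + 1) x rfl
  simp only [jacobiAhat, jacobiBhat, jacobiChat]
  push_cast
  rcases n with _ | n
  · have h2 : (2 : ℝ) + a + b ≠ 0 := by linarith
    have h3 : (2 : ℝ) + a + b + 1 ≠ 0 := by linarith
    have h4 : (2 : ℝ) + a + b + 2 ≠ 0 := by linarith
    have h5 : (1 : ℝ) + a + b + 1 ≠ 0 := by linarith
    simp only [jacobiQ, jacobiP, jacobiA, jacobiB, jacobiC]
    norm_num
    field_simp
    ring
  have hn : (0 : ℝ) ≤ n := Nat.cast_nonneg n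
  push_cast at *
  obtain ⟨k, hk⟩ : ∃ k : ℝ, k = (n : ℝ) + 1 + 1 := ⟨_, rfl⟩
  rw [← hk] at U0 T1 hQ ⊢
  have h1 : k + 1 ≠ 0 := by linarith
  have h2 : 2 * k + a + b + 1 ≠ 0 := by linarith
  have h3 : 2 * k + (a + b) ≠ 0 := by linarith
  have h3b : 2 * k + a + b ≠ 0 := by linarith
  have h4 : k + a + b ≠ 0 := by linarith
  have h5 : 2 * k + a + b + 2 ≠ 0 := by linarith
  generalize jacobiP a b (n + 1) x = P0 at *
  generalize jacobiP a b (n + 1 + 1) x = P1 at *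
  generalize jacobiQ a b (n + 1) x = Q0 at *
  generalize jacobiQ a b (n + 1 + 1) x = Q1 at *
  generalize jacobiQ a b (n + 1 + 2) x = Q2 at *
  have key : (k + (a + b)) * (2 * k + (a + b)) * (2 * k + (a + b) + 1) * (2 * k + (a + b) + 2) * P1 =
      -2 * (k + a) * (k + b) * (2 * k + (a + b) + 2) * Q0
      + 2 * (a - b) * (k + (a + b)) * (2 * k + (a + b) + 1) * Q1
      + 2 * (k + (a + b) + 1) * (k + (a + b)) * (2 * k + (a + b)) * Q2 := by
    apply mul_left_cancel₀ (mul_ne_zero (mul_ne_zero h1 h3) hx)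
    linear_combination -(k + (a + b)) * (2 * k + (a + b)) * (1 - x ^ 2) * hQ
      - (k + (a + b)) * (2 * k + (a + b) + 1) * (2 * (a - b) * (k + 1)
        + (2 * k + (a + b) + 2) * (2 * k + (a + b)) * x + a ^ 2 - b ^ 2) * T1
      + 2 * (k + a) * (k + b) * (2 * k + (a + b) + 2) * (2 * k + (a + b) + 1) * U0
  field_simp
  linear_combination key

theorem frac_integrable (α : ℝ) (hα : 0 < α) (x : ℝ) (f : ℝ → ℝ)
    (hf : Continuous f) :
    IntervalIntegrable (fun s => (x - s) ^ (α - 1) * f s) volume (-1) x := by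
  have h : IntervalIntegrable (fun s : ℝ => s ^ (α - 1)) volume (x - (-1)) (x - x) :=
    intervalIntegrable_rpow' (by linarith)
  have hsub := h.comp_sub_left x
  have h2 : IntervalIntegrable (fun s : ℝ => (x - s) ^ (α - 1)) volume (-1) x := by
    simpa using hsub
  exact h2.mul_continuousOn hf.continuousOn

/-- Recurrence for the left fractional integrals `P̂^{a,b,α}_{L,j}` of the Jacobi
polynomials, for `j ≥ 1`. -/
theorem jacobi_left_frac_integral_rec (a b : ℝ) (ha : -1 < a) (hb : -1 < b)
    (α : ℝ) (hα : 0 < α) (j : ℕ) (hj : 1 ≤ j) (x : ℝ) (hx : x ∈ Set.Ioc (-1 : ℝ) 1) :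
    (1 + α * jacobiA a b j * jacobiChat a b j) *
        ((1 / Real.Gamma α) * ∫ s in (-1 : ℝ)..x, (x - s) ^ (α - 1) * jacobiP a b (j + 1) s)
      = (jacobiA a b j * x - jacobiB a b j - α * jacobiA a b j * jacobiBhat a b j) *
          ((1 / Real.Gamma α) * ∫ s in (-1 : ℝ)..x, (x - s) ^ (α - 1) * jacobiP a b j s)
        - (jacobiC a b j + α * jacobiA a b j * jacobiAhat a b j) *
          ((1 / Real.Gamma α) * ∫ s in (-1 : ℝ)..x, (x - s) ^ (α - 1) * jacobiP a b (j - 1) s)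
        + (α * jacobiA a b j / Real.Gamma (α + 1)) *
            (jacobiAhat a b j * jacobiP a b (j - 1) (-1) + jacobiBhat a b j * jacobiP a b j (-1)
              + jacobiChat a b j * jacobiP a b (j + 1) (-1)) * (x + 1) ^ α := by
  obtain ⟨n, rfl⟩ : ∃ n, j = n + 1 := ⟨j - 1, by omega⟩
  obtain ⟨hx1, hx2⟩ := hx
  rw [show n + 1 - 1 = n from rfl, show n + 1 + 1 = n + 2 from rfl]
  have I0 := frac_integrable α hα x _ (jacobiP_continuous a b n)
  have I1 := frac_integrable α hα x _ (jacobiP_continuous a b (n + 1))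
  have I2 := frac_integrable α hα x _ (jacobiP_continuous a b (n + 2))
  have rel := fun s hs => jacobi_deriv_rel a b ha hb n s hs
  have hrec : ∀ s, jacobiP a b (n + 2) s =
      (jacobiA a b (n + 1) * s - jacobiB a b (n + 1)) * jacobiP a b (n + 1) s -
        jacobiC a b (n + 1) * jacobiP a b n s := fun s => rfl
  have D0 := jacobiP_hasDerivAt a b n
  have D1 := jacobiP_hasDerivAt a b (n + 1)
  have D2 := jacobiP_hasDerivAt a b (n + 2)
  have c0 := jacobiP_continuous a b n
  have c1 := jacobiP_continuous a b (n + 1)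
  have c2 := jacobiP_continuous a b (n + 2)
  generalize jacobiP a b n = P0 at *
  generalize jacobiP a b (n + 1) = P1 at *
  generalize jacobiP a b (n + 2) = P2 at *
  generalize jacobiA a b (n + 1) = A at *
  generalize jacobiB a b (n + 1) = B at *
  generalize jacobiC a b (n + 1) = C at *
  generalize jacobiAhat a b (n + 1) = Ahat at *
  generalize jacobiBhat a b (n + 1) = Bhat at *
  generalize jacobiChat a b (n + 1) = Chat at *
  have hcont : Continuous fun s : ℝ => (x - s) ^ α :=
    (continuous_const.sub continuous_id).rpow_const fun _ => Or.inr hα.le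
  have J1 : IntervalIntegrable (fun s => (x - s) ^ α * P1 s) volume (-1) x :=
    (hcont.mul c1).intervalIntegrable _ _
  have hpow : ∀ s ∈ Set.uIcc (-1) x, (x - s) ^ α = (x - s) * (x - s) ^ (α - 1) := by
    intro s hs
    rw [Set.uIcc_of_le hx1.le] at hs
    rcases hs.2.eq_or_lt with h | h
    · rw [h, sub_self, Real.zero_rpow hα.ne', zero_mul]
    · rw [Real.rpow_sub_one (by linarith)]
      have : x - s ≠ 0 := by linarith
      field_simp
  -- integration by parts
  have parts : ∫ s in (-1 : ℝ)..x, ((x - s) ^ α * P1 s - α * (Ahat * ((x - s) ^ (α - 1) * P0 s)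
      + Bhat * ((x - s) ^ (α - 1) * P1 s) + Chat * ((x - s) ^ (α - 1) * P2 s)))
      = - ((x + 1) ^ α * (Ahat * P0 (-1) + Bhat * P1 (-1) + Chat * P2 (-1))) := by
    rw [integral_eq_sub_of_hasDerivAt_of_le hx1.le
      (f := fun s => (x - s) ^ α * (Ahat * P0 s + Bhat * P1 s + Chat * P2 s))]
    · simp [Real.zero_rpow hα.ne']
    · exact (hcont.mul (by fun_prop)).continuousOn
    · intro s hs
      have hne : 1 - s ^ 2 ≠ 0 := by
        have h1 := hs.1
        have h2 := hs.2
        nlinarith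
      have hd := (((hasDerivAt_id s).const_sub x).rpow_const (p := α)
        (Or.inl (by have := hs.2; simp only [id]; linarith))).mul
        ((((D0 s).const_mul Ahat).add ((D1 s).const_mul Bhat)).add ((D2 s).const_mul Chat))
      rw [← rel s hne] at hd
      refine HasDerivAt.congr_deriv hd ?_
      simp only [id, Pi.add_apply]
      ring
    · exact J1.sub ((((I0.const_mul Ahat).add (I1.const_mul Bhat)).add (I2.const_mul Chat)).const_mul α)
  rw [integral_sub J1 ((((I0.const_mul Ahat).add (I1.const_mul Bhat)).add
    (I2.const_mul Chat)).const_mul α), intervalIntegral.integral_const_mul,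
    integral_add ((I0.const_mul Ahat).add (I1.const_mul Bhat)) (I2.const_mul Chat),
    integral_add (I0.const_mul Ahat) (I1.const_mul Bhat),
    intervalIntegral.integral_const_mul, intervalIntegral.integral_const_mul, intervalIntegral.integral_const_mul] at parts
  have rec2 : ∫ s in (-1 : ℝ)..x, (x - s) ^ (α - 1) * P2 s
      = ∫ s in (-1 : ℝ)..x, ((A * x - B) * ((x - s) ^ (α - 1) * P1 s) - A * ((x - s) ^ α * P1 s)
        - C * ((x - s) ^ (α - 1) * P0 s)) := by
    apply integral_congr
    intro s hs
    simp only
    rw [hrec s, hpow s hs]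
    ring
  rw [integral_sub ((I1.const_mul _).sub (J1.const_mul _)) (I0.const_mul _),
    integral_sub (I1.const_mul _) (J1.const_mul _), intervalIntegral.integral_const_mul, intervalIntegral.integral_const_mul,
    intervalIntegral.integral_const_mul] at rec2
  rw [Real.Gamma_add_one hα.ne']
  have hG : Real.Gamma α ≠ 0 := (Real.Gamma_pos_of_pos hα).ne'
  generalize (∫ s in (-1 : ℝ)..x, (x - s) ^ (α - 1) * P0 s) = X0 at *
  generalize (∫ s in (-1 : ℝ)..x, (x - s) ^ (α - 1) * P1 s) = X1 at *
  generalize (∫ s in (-1 : ℝ)..x, (x - s) ^ (α - 1) * P2 s) = X2 at *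
  generalize (∫ s in (-1 : ℝ)..x, (x - s) ^ α * P1 s) = Y at *
  have hαne := hα.ne'
  generalize (x + 1) ^ α = W at *
  field_simp
  linear_combination rec2 - A * parts
end
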